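/- There do not exist 13 pairwise distinct points A, B₁, B₂, B₃, B₄, C₁, C₂, …, C₈ in ℝ² satisfying all of: (i) no three of the 13 points are collinear and all pairwise distances among them are at least 1; (ii) dist(A,Bᵢ) = 1 for i = 1,2,3,4, these being the only points among the 13 at distance exactly 1 from A; (iii) dist(B₁,Cⱼ) = 1 for j = 1,2,3,4, dist(B₂,Cⱼ) = 1 for j = 5,6,7,8, dist(C₁,C₂) = dist(C₃,C₄) = dist(C₅,C₆) = dist(C₇,C₈) = 1; (iv) B₁ and B₂ are consecutive in the cyclic angular order of B₁, B₂, B₃, B₄ around A (the closed angular sector at A between the rays AB₁ and AB₂ not containing B₃ and B₄); (v) the cyclic angular order of the five points C₁, C₂, C₃, C₄, A around B₁ is exactly C₁, C₂, C₃, C₄, A (in the rotational direction for which C₄ and B₂ lie on the same side of the line AB₁), and the cyclic angular order of the five points A, C₅, C₆, C₇, C₈ around B₂ is exactly A, C₅, C₆, C₇, C₈ (in the rotational direction for which C₅ and B₁ lie on the same side of the line AB₂). -/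

import Mathlib

open Real EuclideanGeometry

/-- The Euclidean plane. -/
abbrev Pt := EuclideanSpace ℝ (Fin 2)

/-- The points of the list `ws` occur in this exact cyclic angular order around `X`,
in the counterclockwise direction: each point lies on a ray from `X` at angle `θ i`,
where the angles are strictly increasing and all lie within one turn. (The cyclic
angular order of points around `X` in a given rotational direction is witnessed by
such a list of angles, cut at an arbitrary reference ray.) -/
def AngOrder (X : Pt) (ws : List Pt) : Prop :=
  ∃ θ : Fin ws.length → ℝ, ∃ r : Fin ws.length → ℝ,
    (∀ i, 0 < r i) ∧ StrictMono θ ∧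
    (∀ i j : Fin ws.length, θ j - θ i < 2 * π) ∧
    ∀ i : Fin ws.length,
      ws.get i = X + r i • (EuclideanSpace.equiv (Fin 2) ℝ).symm
        ![Real.cos (θ i), Real.sin (θ i)]

/-- `P` is the point of the unit circle around `X` at angle `φ`. -/
def AtAngle (X : Pt) (φ : ℝ) (P : Pt) : Prop :=
  P 0 = X 0 + cos φ ∧ P 1 = X 1 + sin φ

/-- Around `X`, the unit neighbours `P` and `S` of `X` are reached from `A` by turning
counterclockwise by `δ` and clockwise by `β`, with `δ, β > π / 3` and `δ + β ≤ π`. -/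
def IsFan (X A P S : Pt) : Prop :=
  ∃ φ δ β : ℝ, π / 3 < δ ∧ π / 3 < β ∧ δ + β ≤ π ∧
    AtAngle X φ A ∧ AtAngle X (φ + δ) P ∧ AtAngle X (φ - β) S

lemma dist_sq_eq (p q : Pt) : dist p q ^ 2 = (p 0 - q 0) ^ 2 + (p 1 - q 1) ^ 2 := by
  rw [EuclideanSpace.dist_eq, Real.sq_sqrt (by positivity), Fin.sum_univ_two,
    Real.dist_eq, Real.dist_eq, sq_abs, sq_abs]

lemma atAngle_of_eq {X P : Pt} {r φ : ℝ} (hr : 0 < r)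
    (h : P = X + r • (EuclideanSpace.equiv (Fin 2) ℝ).symm ![cos φ, sin φ])
    (hd : dist X P = 1) : AtAngle X φ P := by
  have h0 : P 0 = X 0 + r * cos φ := by simp [h]
  have h1 : P 1 = X 1 + r * sin φ := by simp [h]
  have hsq := dist_sq_eq X P
  rw [hd, h0, h1] at hsq
  have hr1 : r = 1 := by
    have hr2 : r ^ 2 = 1 := by
      linear_combination -hsq - r ^ 2 * sin_sq_add_cos_sq φ
    nlinarith
  subst hr1
  exact ⟨by simpa using h0, by simpa using h1⟩

lemma AtAngle.congr {X P : Pt} {φ ψ : ℝ} (h : AtAngle X φ P) (hc : cos ψ = cos φ)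
    (hs : sin ψ = sin φ) : AtAngle X ψ P := by
  unfold AtAngle
  rwa [hc, hs]

lemma AtAngle.add_two_pi {X P : Pt} {φ : ℝ} (h : AtAngle X φ P) :
    AtAngle X (φ + 2 * π) P :=
  h.congr (cos_add_two_pi φ) (sin_add_two_pi φ)

lemma AtAngle.sub_two_pi {X P : Pt} {φ : ℝ} (h : AtAngle X φ P) :
    AtAngle X (φ - 2 * π) P :=
  h.congr (cos_sub_two_pi φ) (sin_sub_two_pi φ)

lemma AtAngle.dist_sq {X P Q : Pt} {φ ψ : ℝ} (hP : AtAngle X φ P) (hQ : AtAngle X ψ Q) :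
    dist P Q ^ 2 = 2 - 2 * cos (ψ - φ) := by
  rw [dist_sq_eq, hP.1, hP.2, hQ.1, hQ.2, cos_sub]
  linear_combination sin_sq_add_cos_sq φ + sin_sq_add_cos_sq ψ

lemma AtAngle.pi_div_three_le {X P Q : Pt} {φ ψ : ℝ} (hP : AtAngle X φ P)
    (hQ : AtAngle X ψ Q) (h : φ < ψ) (hd : 1 ≤ dist P Q) : π / 3 ≤ ψ - φ := by
  by_contra! hlt
  have hcos := cos_lt_cos_of_nonneg_of_le_pi (by linarith : 0 ≤ ψ - φ)
    (by linarith [pi_pos] : π / 3 ≤ π) hlt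
  rw [cos_pi_div_three] at hcos
  nlinarith [hP.dist_sq hQ]

lemma AtAngle.pi_div_three_lt {X P Q : Pt} {φ ψ : ℝ} (hP : AtAngle X φ P)
    (hQ : AtAngle X ψ Q) (h : φ < ψ) (hd : 1 < dist P Q) : π / 3 < ψ - φ := by
  refine (hP.pi_div_three_le hQ h hd.le).lt_of_ne fun he => ?_
  have hsq := hP.dist_sq hQ
  rw [← he, cos_pi_div_three] at hsq
  nlinarith

lemma isFan_of_atAngle {X A P Q R S : Pt} {a p q r s : ℝ} (hap : a < p) (hpq : p < q)
    (hqr : q < r) (hrs : r < s) (hsa : s < a + 2 * π) (hA : AtAngle X a A)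
    (hP : AtAngle X p P) (hQ : AtAngle X q Q) (hR : AtAngle X r R) (hS : AtAngle X s S)
    (dAP : 1 < dist A P) (dPQ : 1 ≤ dist P Q) (dQR : 1 ≤ dist Q R) (dRS : 1 ≤ dist R S)
    (dSA : 1 < dist S A) : IsFan X A P S := by
  refine ⟨a, p - a, a + 2 * π - s, hA.pi_div_three_lt hP hap dAP,
    hS.pi_div_three_lt hA.add_two_pi hsa dSA, ?_, hA, ?_, ?_⟩
  · linarith [hP.pi_div_three_le hQ hpq dPQ, hQ.pi_div_three_le hR hqr dQR,
      hR.pi_div_three_le hS hrs dRS]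
  · rwa [add_sub_cancel]
  · convert hS.sub_two_pi using 1
    ring

lemma isFan_of_angOrder_head {X A P Q R S : Pt} (h : AngOrder X [A, P, Q, R, S])
    (uA : dist X A = 1) (uP : dist X P = 1) (uQ : dist X Q = 1) (uR : dist X R = 1)
    (uS : dist X S = 1) (dAP : 1 < dist A P) (dPQ : 1 ≤ dist P Q) (dQR : 1 ≤ dist Q R)
    (dRS : 1 ≤ dist R S) (dSA : 1 < dist S A) : IsFan X A P S := by
  obtain ⟨θ, r, hr, hθ, hlt, he⟩ := h
  exact isFan_of_atAngle (hθ (show (0 : Fin 5) < 1 by decide))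
    (hθ (show (1 : Fin 5) < 2 by decide)) (hθ (show (2 : Fin 5) < 3 by decide))
    (hθ (show (3 : Fin 5) < 4 by decide))
    (by linarith [hlt (0 : Fin 5) (4 : Fin 5)])
    (atAngle_of_eq (hr (0 : Fin 5)) (he (0 : Fin 5)) uA)
    (atAngle_of_eq (hr (1 : Fin 5)) (he (1 : Fin 5)) uP)
    (atAngle_of_eq (hr (2 : Fin 5)) (he (2 : Fin 5)) uQ)
    (atAngle_of_eq (hr (3 : Fin 5)) (he (3 : Fin 5)) uR)
    (atAngle_of_eq (hr (4 : Fin 5)) (he (4 : Fin 5)) uS) dAP dPQ dQR dRS dSA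

lemma isFan_of_angOrder_last {X A P Q R S : Pt} (h : AngOrder X [P, Q, R, S, A])
    (uA : dist X A = 1) (uP : dist X P = 1) (uQ : dist X Q = 1) (uR : dist X R = 1)
    (uS : dist X S = 1) (dAP : 1 < dist A P) (dPQ : 1 ≤ dist P Q) (dQR : 1 ≤ dist Q R)
    (dRS : 1 ≤ dist R S) (dSA : 1 < dist S A) : IsFan X A P S := by
  obtain ⟨θ, r, hr, hθ, hlt, he⟩ := h
  exact isFan_of_atAngle (a := θ (4 : Fin 5) - 2 * π)
    (by linarith [hlt (0 : Fin 5) (4 : Fin 5)])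
    (hθ (show (0 : Fin 5) < 1 by decide)) (hθ (show (1 : Fin 5) < 2 by decide))
    (hθ (show (2 : Fin 5) < 3 by decide))
    (by linarith [hθ (show (3 : Fin 5) < 4 by decide)])
    (atAngle_of_eq (hr (4 : Fin 5)) (he (4 : Fin 5)) uA).sub_two_pi
    (atAngle_of_eq (hr (0 : Fin 5)) (he (0 : Fin 5)) uP)
    (atAngle_of_eq (hr (1 : Fin 5)) (he (1 : Fin 5)) uQ)
    (atAngle_of_eq (hr (2 : Fin 5)) (he (2 : Fin 5)) uR)
    (atAngle_of_eq (hr (3 : Fin 5)) (he (3 : Fin 5)) uS) dAP dPQ dQR dRS dSA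

/-- The cyclic order around `B` of `C₁, C₂, C₃, C₄, A`, in one of the two rotational
directions, gives a fan in that direction. -/
lemma isFan_or_isFan {A B C₁ C₂ C₃ C₄ : Pt}
    (h : AngOrder B [C₁, C₂, C₃, C₄, A] ∨ AngOrder B [A, C₄, C₃, C₂, C₁])
    (uA : dist A B = 1) (u₁ : dist B C₁ = 1) (u₂ : dist B C₂ = 1) (u₃ : dist B C₃ = 1)
    (u₄ : dist B C₄ = 1) (d₁ : 1 < dist A C₁) (d₁₂ : 1 ≤ dist C₁ C₂) (d₂₃ : 1 ≤ dist C₂ C₃)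
    (d₃₄ : 1 ≤ dist C₃ C₄) (d₄ : 1 < dist A C₄) : IsFan B A C₁ C₄ ∨ IsFan B A C₄ C₁ := by
  rw [dist_comm] at uA
  refine h.imp (fun h => ?_) fun h => ?_
  · exact isFan_of_angOrder_last h uA u₁ u₂ u₃ u₄ d₁ d₁₂ d₂₃ d₃₄ (by rwa [dist_comm])
  · exact isFan_of_angOrder_head h uA u₄ u₃ u₂ u₁ d₄ (by rwa [dist_comm])
      (by rwa [dist_comm]) (by rwa [dist_comm]) (by rwa [dist_comm])

/-- The cross product of `Q - P` and `R - P`. -/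
def cross (P Q R : Pt) : ℝ :=
  (Q 0 - P 0) * (R 1 - P 1) - (Q 1 - P 1) * (R 0 - P 0)

lemma cross_mul_cross_pos {A B P Q : Pt}
    (hAB : dist A B = 1)
    (h : (affineSpan ℝ ({A, B} : Set Pt)).SSameSide P Q) :
    0 < cross A B P * cross A B Q := by
  obtain ⟨⟨p₁, h₁, p₂, h₂, hray⟩, hP, hQ⟩ := h
  have hne₁ : P -ᵥ p₁ ≠ 0 := fun h0 => hP (vsub_eq_zero_iff_eq.1 h0 ▸ h₁)
  have hne₂ : Q -ᵥ p₂ ≠ 0 := fun h0 => hQ (vsub_eq_zero_iff_eq.1 h0 ▸ h₂)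
  obtain ⟨r, hr, he⟩ := hray.exists_pos_left hne₁ hne₂
  obtain ⟨s, rfl⟩ := mem_affineSpan_pair_iff_exists_lineMap_eq.1 h₁
  obtain ⟨t, rfl⟩ := mem_affineSpan_pair_iff_exists_lineMap_eq.1 h₂
  have e0 := congrFun (congrArg WithLp.ofLp he) 0
  have e1 := congrFun (congrArg WithLp.ofLp he) 1
  simp [AffineMap.lineMap_apply] at e0 e1
  have key : cross A B Q = r * cross A B P := by
    unfold cross
    linear_combination (B 1 - A 1) * e0 - (B 0 - A 0) * e1
  have hnz : cross A B P ≠ 0 := by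
    intro hz
    have hsq := dist_sq_eq A B
    rw [hAB] at hsq
    unfold cross at hz
    refine hP (mem_affineSpan_pair_iff_exists_lineMap_eq.2
      ⟨(P 0 - A 0) * (B 0 - A 0) + (P 1 - A 1) * (B 1 - A 1), ?_⟩)
    ext i
    fin_cases i
    · simp [AffineMap.lineMap_apply]
      linear_combination -(P 0 - A 0) * hsq + (B 1 - A 1) * hz
    · simp [AffineMap.lineMap_apply]
      linear_combination -(P 1 - A 1) * hsq - (B 0 - A 0) * hz
  rw [key]
  have := sq_pos_of_ne_zero hnz
  nlinarith [mul_pos hr this]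

/-- A quadrilateral with three consecutive unit sides enclosing angles `x` and `y` with
`x + y < π` has a fourth side shorter than one. -/
lemma cos_add_lt {x y : ℝ} (hx : 0 < x) (hy : 0 < y) (h : x + y < π) :
    1 - cos x - cos y + cos (x + y) < 0 := by
  have hx2 : 0 < sin (x / 2) := sin_pos_of_pos_of_lt_pi (by linarith) (by linarith)
  have hy2 : 0 < sin (y / 2) := sin_pos_of_pos_of_lt_pi (by linarith) (by linarith)
  have hm : 0 < cos (x / 2 + y / 2) :=
    cos_pos_of_mem_Ioo ⟨by linarith, by linarith⟩
  have key : 1 - cos x - cos y + cos (x + y) =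
      -4 * (sin (x / 2) * sin (y / 2) * cos (x / 2 + y / 2)) := by
    obtain ⟨u, rfl⟩ : ∃ u, x = 2 * u := ⟨x / 2, by ring⟩
    obtain ⟨v, rfl⟩ : ∃ v, y = 2 * v := ⟨y / 2, by ring⟩
    rw [mul_div_cancel_left₀ _ two_ne_zero, mul_div_cancel_left₀ _ two_ne_zero]
    simp only [cos_add, cos_two_mul, sin_two_mul]
    linear_combination (4 * cos v ^ 2 - 4) * sin_sq_add_cos_sq u -
      4 * sin u ^ 2 * sin_sq_add_cos_sq v
  rw [key]
  have := mul_pos (mul_pos hx2 hy2) hm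
  linarith

/-- A pentagon with four consecutive unit sides enclosing the angles `β, α, γ`
has its fifth side shorter than one if these angles sum to at most `5 * π / 3`. -/
lemma pentagon_side_sq_lt {α β γ : ℝ} (hβ : π / 3 < β) (hγ : π / 3 < γ)
    (hβ' : β < 2 * π / 3) (hγ' : γ < 2 * π / 3) (hαβ : π ≤ α + β) (hαγ : π ≤ α + γ)
    (hsum : α + β + γ ≤ 5 * π / 3) :
    4 - 2 * (cos α + cos β + cos γ - cos (α + β) - cos (α + γ) + cos (α + β + γ)) < 1 := by
  obtain ⟨p, rfl⟩ : ∃ p, β = π / 3 + 2 * p := ⟨(β - π / 3) / 2, by ring⟩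
  obtain ⟨q, rfl⟩ : ∃ q, γ = π / 3 + 2 * q := ⟨(γ - π / 3) / 2, by ring⟩
  obtain ⟨r, rfl⟩ : ∃ r, α = π - 2 * p - 2 * q - 2 * r :=
    ⟨(π - 2 * p - 2 * q - α) / 2, by ring⟩
  have hp : 0 < sin p := sin_pos_of_pos_of_lt_pi (by linarith) (by linarith)
  have hq : 0 < sin q := sin_pos_of_pos_of_lt_pi (by linarith) (by linarith)
  have hr : 0 ≤ sin r := sin_nonneg_of_nonneg_of_le_pi (by linarith) (by linarith)
  have hpq : 0 < cos (p + q) := cos_pos_of_mem_Ioo ⟨by linarith, by linarith⟩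
  have hpqr : 0 ≤ sin (π / 3 - p - q - r) :=
    sin_nonneg_of_nonneg_of_le_pi (by linarith) (by linarith)
  have hlast : 0 ≤ cos (p - q) - cos (π / 3 + p + q) := by
    rw [sub_nonneg, ← cos_abs (p - q)]
    exact cos_le_cos_of_nonneg_of_le_pi (abs_nonneg _) (by linarith)
      (abs_le.2 ⟨by linarith, by linarith⟩)
  have key : 4 - 2 * (cos (π - 2 * p - 2 * q - 2 * r) + cos (π / 3 + 2 * p) +
      cos (π / 3 + 2 * q) - cos (π - 2 * p - 2 * q - 2 * r + (π / 3 + 2 * p)) -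
      cos (π - 2 * p - 2 * q - 2 * r + (π / 3 + 2 * q)) +
      cos (π - 2 * p - 2 * q - 2 * r + (π / 3 + 2 * p) + (π / 3 + 2 * q))) =
      1 - 8 * (sin p * sin q * cos (p + q)) - 8 * (sin r * sin (π / 3 - p - q - r) *
        (cos (p - q) - cos (π / 3 + p + q))) := by
    have e₁ : cos (π - 2 * p - 2 * q - 2 * r) = -cos (2 * p + 2 * q + 2 * r) := by
      rw [← cos_pi_sub]; ring_nf
    have e₂ : cos (π - 2 * p - 2 * q - 2 * r + (π / 3 + 2 * p)) =
        -cos (π / 3 - 2 * q - 2 * r) := by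
      rw [← cos_add_pi]; ring_nf
    have e₃ : cos (π - 2 * p - 2 * q - 2 * r + (π / 3 + 2 * q)) =
        -cos (π / 3 - 2 * p - 2 * r) := by
      rw [← cos_add_pi]; ring_nf
    have e₄ : cos (π - 2 * p - 2 * q - 2 * r + (π / 3 + 2 * p) + (π / 3 + 2 * q)) =
        cos (π / 3 + 2 * r) := by
      rw [← cos_two_pi_sub]; ring_nf
    have f₁ : 4 * (sin p * sin q * cos (p + q)) =
        cos (2 * p) + cos (2 * q) - 1 - cos (2 * p + 2 * q) := by
      rw [cos_add_cos, show 2 * p + 2 * q = 2 * (p + q) by ring, cos_two_mul,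
        show 2 * (p + q) / 2 = p + q by ring, show (2 * p - 2 * q) / 2 = p - q by ring]
      linear_combination 2 * cos (p + q) * two_mul_sin_mul_sin p q
    have f₂ : 2 * sin (π / 3 - p - q - r) * cos (p - q) =
        sin (π / 3 - 2 * p - r) + sin (π / 3 - 2 * q - r) := by
      rw [two_mul_sin_mul_cos]; ring_nf
    have f₃ : 2 * sin (π / 3 - p - q - r) * cos (π / 3 + p + q) =
        sin (π / 3 + r) - sin (2 * p + 2 * q + r) := by
      rw [two_mul_sin_mul_cos, ← sin_pi_sub (π / 3 + r),
        show π / 3 - p - q - r - (π / 3 + p + q) = -(2 * p + 2 * q + r) by ring, sin_neg]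
      ring_nf
    have f₄ (x : ℝ) : 2 * sin (x + r) * sin r = cos x - cos (x + 2 * r) := by
      rw [two_mul_sin_mul_sin]; ring_nf
    have f₅ (x : ℝ) : 2 * sin (π / 3 - x - r) * sin r =
        cos (π / 3 - x - 2 * r) - cos (π / 3 - x) := by
      rw [two_mul_sin_mul_sin]; ring_nf
    have f₆ (x : ℝ) : cos (π / 3 + x) + cos (π / 3 - x) = cos x := by
      rw [cos_add, cos_sub, cos_pi_div_three]; ring
    rw [e₁, e₂, e₃, e₄]
    linear_combination 2 * f₁ + 4 * sin r * (f₂ - f₃) + 2 * f₅ (2 * p) + 2 * f₅ (2 * q) +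
      2 * f₄ (2 * p + 2 * q) - 2 * f₄ (π / 3) - 2 * f₆ (2 * p) - 2 * f₆ (2 * q)
      - 2 * cos_pi_div_three
  rw [key]
  have h1 := mul_pos (mul_pos hp hq) hpq
  have h2 := mul_nonneg (mul_nonneg hr hpqr) hlast
  linarith

lemma IsFan.exists_atAngle {A B P S : Pt} {θ : ℝ} (hB : AtAngle A θ B) (h : IsFan B A P S) :
    ∃ δ β : ℝ, π / 3 < δ ∧ π / 3 < β ∧ δ + β ≤ π ∧
      AtAngle B (θ + δ + π) P ∧ AtAngle B (θ - β + π) S := by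
  obtain ⟨φ, δ, β, hδ, hβ, hsum, hA, hP, hS⟩ := h
  have hc : cos φ = -cos θ := by linarith [hA.1, hB.1]
  have hs : sin φ = -sin θ := by linarith [hA.2, hB.2]
  refine ⟨δ, β, hδ, hβ, hsum, hP.congr ?_ ?_, hS.congr ?_ ?_⟩
  · rw [cos_add_pi, cos_add, cos_add, hc, hs]
    ring
  · rw [sin_add_pi, sin_add, sin_add, hc, hs]
    ring
  · rw [cos_add_pi, cos_sub, cos_sub, hc, hs]
    ring
  · rw [sin_add_pi, sin_sub, sin_sub, hc, hs]
    ring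

lemma AtAngle.cross_left {A B Q : Pt} {θ ψ : ℝ} (hB : AtAngle A θ B) (hQ : AtAngle A ψ Q) :
    cross A B Q = sin (ψ - θ) := by
  rw [cross, hB.1, hB.2, hQ.1, hQ.2, sin_sub]
  ring

lemma AtAngle.cross_right {A B P : Pt} {θ φ : ℝ} (hB : AtAngle A θ B) (hP : AtAngle B φ P) :
    cross A B P = sin (φ - θ) := by
  rw [cross, hP.1, hP.2, hB.1, hB.2, sin_sub]
  ring

lemma quadrilateral_side_sq {A B P Q : Pt} {θ δ η : ℝ} (hB : AtAngle A θ B)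
    (hP : AtAngle B (θ + δ + π) P) (hQ : AtAngle A (θ - η) Q) :
    dist Q P ^ 2 = 3 - 2 * cos η - 2 * cos δ + 2 * cos (η + δ) := by
  have h₁ : cos η = cos (θ - (θ - η)) := by ring_nf
  have h₂ : cos δ = cos (θ + δ - θ) := by ring_nf
  have h₃ : cos (η + δ) = cos (θ + δ - (θ - η)) := by ring_nf
  rw [dist_sq_eq, hP.1, hP.2, hB.1, hB.2, hQ.1, hQ.2, cos_add_pi, sin_add_pi,
    h₁, h₂, h₃, cos_sub θ (θ - η), cos_sub (θ + δ) θ, cos_sub (θ + δ) (θ - η)]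
  linear_combination sin_sq_add_cos_sq θ + sin_sq_add_cos_sq (θ + δ) +
    sin_sq_add_cos_sq (θ - η)

lemma pi_le_add_of_one_le_dist {A B P Q : Pt} {θ δ η : ℝ} (hB : AtAngle A θ B)
    (hP : AtAngle B (θ + δ + π) P) (hQ : AtAngle A (θ - η) Q) (hδ : 0 < δ) (hη : 0 < η)
    (h : 1 ≤ dist Q P) : π ≤ η + δ := by
  by_contra! hlt
  nlinarith [quadrilateral_side_sq hB hP hQ, cos_add_lt hη hδ hlt]

lemma pi_le_add_of_one_le_dist' {A B S Q : Pt} {θ α β : ℝ} (hB : AtAngle A θ B)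
    (hS : AtAngle B (θ - β + π) S) (hQ : AtAngle A (θ + α) Q) (hα : 0 < α) (hβ : 0 < β)
    (h : 1 ≤ dist Q S) : π ≤ α + β := by
  by_contra! hlt
  have hsq := quadrilateral_side_sq (δ := -β) (η := -α) hB (by rwa [← sub_eq_add_neg])
    (by simpa using hQ)
  rw [← neg_add, cos_neg, cos_neg, cos_neg] at hsq
  nlinarith [cos_add_lt hα hβ hlt]

lemma pentagon_side_sq {A B₁ B₂ S P : Pt} {θ α β γ : ℝ} (h₁ : AtAngle A θ B₁)
    (h₂ : AtAngle A (θ + α) B₂) (hS : AtAngle B₁ (θ - β + π) S)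
    (hP : AtAngle B₂ (θ + α + γ + π) P) :
    dist S P ^ 2 =
      4 - 2 * (cos α + cos β + cos γ - cos (α + β) - cos (α + γ) + cos (α + β + γ)) := by
  have e₁ : cos α = cos (θ + α - θ) := by ring_nf
  have e₂ : cos β = cos (θ - (θ - β)) := by ring_nf
  have e₃ : cos γ = cos (θ + α + γ - (θ + α)) := by ring_nf
  have e₄ : cos (α + β) = cos (θ + α - (θ - β)) := by ring_nf
  have e₅ : cos (α + γ) = cos (θ + α + γ - θ) := by ring_nf
  have e₆ : cos (α + β + γ) = cos (θ + α + γ - (θ - β)) := by ring_nf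
  rw [dist_sq_eq, hS.1, hS.2, hP.1, hP.2, h₁.1, h₁.2, h₂.1, h₂.2,
    cos_add_pi, sin_add_pi, cos_add_pi, sin_add_pi, e₁, e₂, e₃, e₄, e₅, e₆,
    cos_sub (θ + α) θ, cos_sub θ (θ - β), cos_sub (θ + α + γ) (θ + α),
    cos_sub (θ + α) (θ - β), cos_sub (θ + α + γ) θ, cos_sub (θ + α + γ) (θ - β)]
  linear_combination sin_sq_add_cos_sq θ + sin_sq_add_cos_sq (θ - β) +
    sin_sq_add_cos_sq (θ + α) + sin_sq_add_cos_sq (θ + α + γ)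

/-- The points of the configuration at the boundary of the two fans around `B₁` and `B₂`
cannot exist when `B₁, B₂, B₃, B₄` is the counterclockwise order around `A`. -/
lemma false_of_isFan {A B₁ B₂ B₃ B₄ C₁ C₄ C₅ C₈ : Pt} (h : AngOrder A [B₁, B₂, B₃, B₄])
    (u₁ : dist A B₁ = 1) (u₂ : dist A B₂ = 1) (u₃ : dist A B₃ = 1) (u₄ : dist A B₄ = 1)
    (d₂₃ : 1 ≤ dist B₂ B₃) (d₃₄ : 1 ≤ dist B₃ B₄) (d₄₁ : 1 ≤ dist B₄ B₁)
    (f₁ : IsFan B₁ A C₁ C₄ ∨ IsFan B₁ A C₄ C₁) (f₂ : IsFan B₂ A C₅ C₈ ∨ IsFan B₂ A C₈ C₅)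
    (s₁ : (affineSpan ℝ ({A, B₁} : Set Pt)).SSameSide C₄ B₂)
    (s₂ : (affineSpan ℝ ({A, B₂} : Set Pt)).SSameSide C₅ B₁)
    (dB₄C₁ : 1 ≤ dist B₄ C₁) (dB₃C₈ : 1 ≤ dist B₃ C₈) (dB₂C₄ : 1 ≤ dist B₂ C₄)
    (dB₁C₅ : 1 ≤ dist B₁ C₅) (dC₄C₅ : 1 ≤ dist C₄ C₅) : False := by
  obtain ⟨θ, r, hr, hθ, hlt, he⟩ := h
  obtain ⟨θ₁, hθ₁⟩ : ∃ t, t = θ (0 : Fin 4) := ⟨_, rfl⟩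
  obtain ⟨α, hα⟩ : ∃ t, θ₁ + t = θ (1 : Fin 4) := ⟨θ (1 : Fin 4) - θ₁, by ring⟩
  obtain ⟨ζ, hζ⟩ : ∃ t, θ₁ + α + t = θ (2 : Fin 4) := ⟨θ (2 : Fin 4) - (θ₁ + α), by ring⟩
  obtain ⟨η, hη⟩ : ∃ t, θ₁ - t + 2 * π = θ (3 : Fin 4) :=
    ⟨θ₁ + 2 * π - θ (3 : Fin 4), by ring⟩
  have a₁ : AtAngle A (θ (0 : Fin 4)) B₁ :=
    atAngle_of_eq (hr (0 : Fin 4)) (he (0 : Fin 4)) u₁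
  have a₂ : AtAngle A (θ (1 : Fin 4)) B₂ :=
    atAngle_of_eq (hr (1 : Fin 4)) (he (1 : Fin 4)) u₂
  have a₃ : AtAngle A (θ (2 : Fin 4)) B₃ :=
    atAngle_of_eq (hr (2 : Fin 4)) (he (2 : Fin 4)) u₃
  have a₄ : AtAngle A (θ (3 : Fin 4)) B₄ :=
    atAngle_of_eq (hr (3 : Fin 4)) (he (3 : Fin 4)) u₄
  have l₁₂ := hθ (show (0 : Fin 4) < 1 by decide)
  have l₂₃ := hθ (show (1 : Fin 4) < 2 by decide)
  have l₃₄ := hθ (show (2 : Fin 4) < 3 by decide)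
  have l₄₁ := hlt (0 : Fin 4) (3 : Fin 4)
  rw [← hθ₁] at a₁ l₁₂ l₄₁
  rw [← hα] at a₂ l₁₂ l₂₃
  rw [← hζ] at a₃ l₂₃ l₃₄
  rw [← hη] at a₄ l₃₄ l₄₁
  have g₂₃ := a₂.pi_div_three_le a₃ l₂₃ d₂₃
  have g₃₄ := a₃.pi_div_three_le a₄ l₃₄ d₃₄
  have g₄₁ := a₄.pi_div_three_le a₁.add_two_pi (by linarith) d₄₁
  replace a₄ := a₄.sub_two_pi
  rw [add_sub_cancel_right] at a₄
  have hsinα : 0 ≤ sin α := sin_nonneg_of_nonneg_of_le_pi (by linarith) (by linarith)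
  have p₁ := cross_mul_cross_pos u₁ s₁
  have p₂ := cross_mul_cross_pos u₂ s₂
  rw [a₁.cross_left a₂, add_sub_cancel_left] at p₁
  rw [a₂.cross_left a₁, sub_add_cancel_left, sin_neg] at p₂
  obtain ⟨δ₁, β, hδ₁, hβ, hδβ, c₁, c₄⟩ :
      ∃ δ β : ℝ, π / 3 < δ ∧ π / 3 < β ∧ δ + β ≤ π ∧
        AtAngle B₁ (θ₁ + δ + π) C₁ ∧ AtAngle B₁ (θ₁ - β + π) C₄ := by
    refine f₁.elim (fun f => f.exists_atAngle a₁) fun f => ?_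
    obtain ⟨δ, β, hδ, hβ, hsum, hP, -⟩ := f.exists_atAngle a₁
    have hs : 0 < sin δ := sin_pos_of_pos_of_lt_pi (by linarith [pi_pos]) (by linarith [pi_pos])
    rw [a₁.cross_right hP, show θ₁ + δ + π - θ₁ = δ + π by ring, sin_add_pi] at p₁
    nlinarith
  obtain ⟨γ, δ₂, hγ, hδ₂, hγδ, c₅, c₈⟩ :
      ∃ γ δ : ℝ, π / 3 < γ ∧ π / 3 < δ ∧ γ + δ ≤ π ∧
        AtAngle B₂ (θ₁ + α + γ + π) C₅ ∧ AtAngle B₂ (θ₁ + α - δ + π) C₈ := by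
    refine f₂.elim (fun f => f.exists_atAngle a₂) fun f => ?_
    obtain ⟨δ, β, hδ, hβ, hsum, -, hS⟩ := f.exists_atAngle a₂
    have hs : 0 < sin β := sin_pos_of_pos_of_lt_pi (by linarith [pi_pos]) (by linarith [pi_pos])
    rw [a₂.cross_right hS, show θ₁ + α - β + π - (θ₁ + α) = π - β by ring, sin_pi_sub] at p₂
    nlinarith
  have hπ := pi_pos
  have q₁ := pi_le_add_of_one_le_dist a₁ c₁ a₄ (by linarith) (by linarith) dB₄C₁
  have q₂ := pi_le_add_of_one_le_dist' a₂ c₈ a₃ (by linarith) (by linarith) dB₃C₈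
  have q₃ := pi_le_add_of_one_le_dist' a₁ c₄ a₂ (by linarith) (by linarith) dB₂C₄
  have q₄ := pi_le_add_of_one_le_dist (η := α) a₂ c₅ (by rwa [add_sub_cancel_right])
    (by linarith) (by linarith) dB₁C₅
  have hlt := pentagon_side_sq_lt hβ hγ (by linarith) (by linarith) q₃ q₄ (by linarith)
  rw [← pentagon_side_sq a₁ a₂ c₄ c₅] at hlt
  nlinarith

/-- The forbidden 13-point configuration (Lemma 9, Figure 10a): there do not exist 13
pairwise distinct points, no three collinear, with all pairwise distances at least 1,
such that `A` has exactly the four unit-neighbors `B₁, B₂, B₃, B₄` among them with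
`B₁` and `B₂` consecutive in the cyclic angular order around `A`, the points
`C₁, C₂, C₃, C₄` (resp. `C₅, C₆, C₇, C₈`) are unit-neighbors of `B₁` (resp. `B₂`)
arranged as stated around `B₁` (resp. `B₂`), and `C₁C₂`, `C₃C₄`, `C₅C₆`, `C₇C₈` are
unit distances. -/
theorem no_thirteen_point_configuration :
    ¬ ∃ A B₁ B₂ B₃ B₄ C₁ C₂ C₃ C₄ C₅ C₆ C₇ C₈ : Pt,
      List.Pairwise (· ≠ ·) [A, B₁, B₂, B₃, B₄, C₁, C₂, C₃, C₄, C₅, C₆, C₇, C₈] ∧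
      -- (i) no three of the 13 points are collinear, and all pairwise distances ≥ 1
      (∀ p ∈ [A, B₁, B₂, B₃, B₄, C₁, C₂, C₃, C₄, C₅, C₆, C₇, C₈],
        ∀ q ∈ [A, B₁, B₂, B₃, B₄, C₁, C₂, C₃, C₄, C₅, C₆, C₇, C₈],
        ∀ r ∈ [A, B₁, B₂, B₃, B₄, C₁, C₂, C₃, C₄, C₅, C₆, C₇, C₈],
        p ≠ q → p ≠ r → q ≠ r → ¬ Collinear ℝ ({p, q, r} : Set Pt)) ∧
      (∀ p ∈ [A, B₁, B₂, B₃, B₄, C₁, C₂, C₃, C₄, C₅, C₆, C₇, C₈],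
        ∀ q ∈ [A, B₁, B₂, B₃, B₄, C₁, C₂, C₃, C₄, C₅, C₆, C₇, C₈],
        p ≠ q → 1 ≤ dist p q) ∧
      -- (ii) `B₁, B₂, B₃, B₄` are exactly the points at distance 1 from `A`
      dist A B₁ = 1 ∧ dist A B₂ = 1 ∧ dist A B₃ = 1 ∧ dist A B₄ = 1 ∧
      (∀ p ∈ [B₁, B₂, B₃, B₄, C₁, C₂, C₃, C₄, C₅, C₆, C₇, C₈],
        dist A p = 1 → p = B₁ ∨ p = B₂ ∨ p = B₃ ∨ p = B₄) ∧
      -- (iii) unit distances from `B₁`, `B₂` and among the `Cⱼ`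
      dist B₁ C₁ = 1 ∧ dist B₁ C₂ = 1 ∧ dist B₁ C₃ = 1 ∧ dist B₁ C₄ = 1 ∧
      dist B₂ C₅ = 1 ∧ dist B₂ C₆ = 1 ∧ dist B₂ C₇ = 1 ∧ dist B₂ C₈ = 1 ∧
      dist C₁ C₂ = 1 ∧ dist C₃ C₄ = 1 ∧ dist C₅ C₆ = 1 ∧ dist C₇ C₈ = 1 ∧
      -- (iv) `B₁` and `B₂` are consecutive in the cyclic angular order around `A`
      (AngOrder A [B₁, B₂, B₃, B₄] ∨ AngOrder A [B₁, B₂, B₄, B₃] ∨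
        AngOrder A [B₂, B₁, B₃, B₄] ∨ AngOrder A [B₂, B₁, B₄, B₃]) ∧
      -- (v) the cyclic angular order around `B₁` is exactly `C₁, C₂, C₃, C₄, A`,
      -- in the rotational direction for which `C₄` and `B₂` lie on the same side of
      -- the line `A B₁`
      (AngOrder B₁ [C₁, C₂, C₃, C₄, A] ∨ AngOrder B₁ [A, C₄, C₃, C₂, C₁]) ∧
      (affineSpan ℝ ({A, B₁} : Set Pt)).SSameSide C₄ B₂ ∧
      -- and the cyclic angular order around `B₂` is exactly `A, C₅, C₆, C₇, C₈`,
      -- in the rotational direction for which `C₅` and `B₁` lie on the same side of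
      -- the line `A B₂`
      (AngOrder B₂ [A, C₅, C₆, C₇, C₈] ∨ AngOrder B₂ [C₈, C₇, C₆, C₅, A]) ∧
      (affineSpan ℝ ({A, B₂} : Set Pt)).SSameSide C₅ B₁ := by
  rintro ⟨A, B₁, B₂, B₃, B₄, C₁, C₂, C₃, C₄, C₅, C₆, C₇, C₈, hne, -, hsep, u₁, u₂, u₃, u₄, hA,
    v₁, v₂, v₃, v₄, v₅, v₆, v₇, v₈, -, -, -, -, hB, hC, s₁, hC', s₂⟩
  have hBC := ((List.pairwise_append (l₁ := [A, B₁, B₂, B₃, B₄])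
    (l₂ := [C₁, C₂, C₃, C₄, C₅, C₆, C₇, C₈])).1 hne).2.2
  have hstrict (C : Pt) (hC : C ∈ [C₁, C₂, C₃, C₄, C₅, C₆, C₇, C₈]) : 1 < dist A C := by
    refine (hsep A (by simp) C (List.mem_append_right [A, B₁, B₂, B₃, B₄] hC)
      (hBC A (by simp) C hC)).lt_of_ne' fun he => ?_
    rcases hA C (List.mem_append_right [B₁, B₂, B₃, B₄] hC) he with h | h | h | h
    · exact hBC B₁ (by simp) C hC h.symm
    · exact hBC B₂ (by simp) C hC h.symm
    · exact hBC B₃ (by simp) C hC h.symm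
    · exact hBC B₄ (by simp) C hC h.symm
  have sep (i j : Fin 13) (hij : i ≠ j) :
      1 ≤ dist ([A, B₁, B₂, B₃, B₄, C₁, C₂, C₃, C₄, C₅, C₆, C₇, C₈].get i)
        ([A, B₁, B₂, B₃, B₄, C₁, C₂, C₃, C₄, C₅, C₆, C₇, C₈].get j) :=
    hsep _ (List.get_mem _ _) _ (List.get_mem _ _)
      fun h => hij ((List.nodup_iff_injective_get.1 hne) h)
  have f₁ : IsFan B₁ A C₁ C₄ ∨ IsFan B₁ A C₄ C₁ :=
    isFan_or_isFan hC u₁ v₁ v₂ v₃ v₄ (hstrict _ (by simp)) (sep 5 6 (by decide))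
      (sep 6 7 (by decide)) (sep 7 8 (by decide)) (hstrict _ (by simp))
  have f₂ : IsFan B₂ A C₅ C₈ ∨ IsFan B₂ A C₈ C₅ :=
    (isFan_or_isFan hC'.symm u₂ v₈ v₇ v₆ v₅ (hstrict _ (by simp)) (sep 12 11 (by decide))
      (sep 11 10 (by decide)) (sep 10 9 (by decide)) (hstrict _ (by simp))).symm
  rcases hB with h | h | h | h
  · exact false_of_isFan h u₁ u₂ u₃ u₄ (sep 2 3 (by decide)) (sep 3 4 (by decide))
      (sep 4 1 (by decide)) f₁ f₂ s₁ s₂ (sep 4 5 (by decide)) (sep 3 12 (by decide))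
      (sep 2 8 (by decide)) (sep 1 9 (by decide)) (sep 8 9 (by decide))
  · exact false_of_isFan h u₁ u₂ u₄ u₃ (sep 2 4 (by decide)) (sep 4 3 (by decide))
      (sep 3 1 (by decide)) f₁ f₂ s₁ s₂ (sep 3 5 (by decide)) (sep 4 12 (by decide))
      (sep 2 8 (by decide)) (sep 1 9 (by decide)) (sep 8 9 (by decide))
  · exact false_of_isFan h u₂ u₁ u₃ u₄ (sep 1 3 (by decide)) (sep 3 4 (by decide))
      (sep 4 2 (by decide)) f₂.symm f₁.symm s₂ s₁ (sep 4 12 (by decide)) (sep 3 5 (by decide))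
      (sep 1 9 (by decide)) (sep 2 8 (by decide)) (sep 9 8 (by decide))
  · exact false_of_isFan h u₂ u₁ u₄ u₃ (sep 1 4 (by decide)) (sep 4 3 (by decide))
      (sep 3 2 (by decide)) f₂.symm f₁.symm s₂ s₁ (sep 3 12 (by decide)) (sep 4 5 (by decide))
      (sep 1 9 (by decide)) (sep 2 8 (by decide)) (sep 9 8 (by decide))
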